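/- arXiv:2310.20006 — 4 statements merged into one kernel-verified Lean document; each statement's English description precedes it below -/
import Mathlib

section
/- Let k be an algebraically closed field of characteristic different from 2, let m ≥ 0 be an integer, and let μ₀ ∈ k satisfy μ₀² = (−1)^{m+1}. Then for every nonzero s ∈ k there exist power series a, b, c, d ∈ k[[t]] with a·d − b·c = 1 such that the following three identities hold in the Laurent series field k((t)): (1) a²·t^{m+1} + b²·t^{−1} = Σ_{i=0}^{m+1} (−s²)^{m+1−i}·t^{i−1}; (2) a·c·t^{m+1} + b·d·t^{−1} = μ₀·s^{m+2}·t^{−1}; (3) c²·t^{m+1} + d²·t^{−1} = s²·t^{−1} + 1. Equivalently, the matrix g = [[a, b], [c, d]] ∈ SL₂(k[[t]]) satisfies g · diag(t^{m+1}, t^{−1}) · gᵀ = [[Σ_{i=0}^{m+1}(−s²)^{m+1−i}t^{i−1}, μ₀ s^{m+2} t^{−1}], [μ₀ s^{m+2} t^{−1}, s² t^{−1} + 1]]. -/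
/-- The element `t` of the field of formal Laurent series `k((t))`. -/
noncomputable def laurentT (k : Type*) [Field k] : LaurentSeries k :=
  HahnSeries.single (1 : ℤ) (1 : k)

open PowerSeries in
/-- The polynomial `s ^ 2 + X` has a square root in `k⟦X⟧` when `s` and `2` are invertible,
expressed through the Catalan generating function. -/
theorem PowerSeries.exists_sq_eq_C_sq_add_X {k : Type*} [Field k] (h2 : (2 : k) ≠ 0) {s : k}
    (hs : s ≠ 0) : ∃ d : PowerSeries k, d ^ 2 = C (s ^ 2) + X := by
  set r : k := -(4 * s ^ 2)⁻¹ with hr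
  set c : PowerSeries k := rescale r (map (Nat.castRingHom k) catalanSeries) with hc
  have hcat : c ^ 2 * (C r * X) + 1 = c := by
    have h := congrArg (fun f => rescale r (map (Nat.castRingHom k) f))
      catalanSeries_sq_mul_X_add_one
    simpa [rescale_X] using h
  have h4 : (4 : k) ≠ 0 := by
    rw [show (4 : k) = 2 * 2 by norm_num]
    exact mul_ne_zero h2 h2
  have hrs : 4 * C (s ^ 2) * C r = (-1 : PowerSeries k) := by
    have h : 4 * s ^ 2 * r = -1 := by
      rw [hr]
      field_simp
    simpa [show C (4 : k) = (4 : PowerSeries k) from map_ofNat C 4] using congrArg (C (R := k)) h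
  refine ⟨C s * (1 - 2 * (C r * X) * c), ?_⟩
  rw [map_pow] at hrs ⊢
  linear_combination 4 * C s ^ 2 * (C r * X) * hcat - X * hrs

open PowerSeries in
/-- The entries of an upper triangular matrix of determinant one over `k⟦X⟧` for which
`g * diag (X ^ n, 1) * gᵀ` has constant off-diagonal entry `q` and lower right entry `s ^ 2 + X`. -/
theorem PowerSeries.exists_upper_triangular_congruence {k : Type*} [Field k] (h2 : (2 : k) ≠ 0)
    (n : ℕ) {q s : k} (hs : s ≠ 0) (hq : q ^ 2 = -(-s ^ 2) ^ n) :
    ∃ a b d : PowerSeries k, a * d = 1 ∧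
      a ^ 2 * X ^ n + b ^ 2 = ∑ i ∈ Finset.range n, X ^ i * C (-s ^ 2) ^ (n - 1 - i) ∧
      b * d = C q ∧ d ^ 2 = C (s ^ 2) + X := by
  obtain ⟨d, hd⟩ := exists_sq_eq_C_sq_add_X h2 hs
  have hd0 : constantCoeff d ≠ 0 := by
    intro h
    have := congrArg (constantCoeff (R := k)) hd
    exact pow_ne_zero 2 hs (by simpa [h] using this.symm)
  have had : d⁻¹ * d = 1 := PowerSeries.inv_mul_cancel d hd0
  refine ⟨d⁻¹, C q * d⁻¹, d, had, ?_, by rw [mul_assoc, had, mul_one], hd⟩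
  have hgeom := (Commute.all (X : PowerSeries k) (C (-s ^ 2))).geom_sum₂_mul n
  have hq' := congrArg (C (R := k)) hq
  rw [map_pow, map_neg, map_pow] at hq'
  rw [map_neg (C (R := k)) (s ^ 2)] at *
  set P := ∑ i ∈ Finset.range n, X ^ i * (-C (s ^ 2)) ^ (n - 1 - i)
  linear_combination (d⁻¹) ^ 2 * hq' - (d⁻¹) ^ 2 * hgeom - (d⁻¹) ^ 2 * P * hd
    + P * (d⁻¹ * d + 1) * had

/-- Proposition (GL₂/O₂ closure curve): for an algebraically closed field `k` of
characteristic `≠ 2`, `m ≥ 0`, `μ₀² = (−1)^{m+1}` and `s ≠ 0`, there exist power series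
`a, b, c, d ∈ k[[t]]` with `a·d − b·c = 1` satisfying the three Laurent series identities,
i.e. the matrix `g = [[a,b],[c,d]] ∈ SL₂(k[[t]])` satisfies
`g · diag(t^{m+1}, t^{−1}) · gᵀ` equals the displayed symmetric matrix. -/
theorem gl2_o2_closure_curve (k : Type*) [Field k] [IsAlgClosed k]
    (hchar : ringChar k ≠ 2) (m : ℕ) (μ₀ : k) (hμ : μ₀ ^ 2 = (-1 : k) ^ (m + 1))
    (s : k) (hs : s ≠ 0) :
    ∃ a b c d : PowerSeries k,
      a * d - b * c = 1 ∧
      (HahnSeries.ofPowerSeries ℤ k a) ^ 2 * laurentT k ^ ((m : ℤ) + 1)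
          + (HahnSeries.ofPowerSeries ℤ k b) ^ 2 * laurentT k ^ (-1 : ℤ)
        = ∑ i ∈ Finset.range (m + 2),
            algebraMap k (LaurentSeries k) ((-s ^ 2) ^ (m + 1 - i))
              * laurentT k ^ ((i : ℤ) - 1) ∧
      (HahnSeries.ofPowerSeries ℤ k a) * (HahnSeries.ofPowerSeries ℤ k c)
            * laurentT k ^ ((m : ℤ) + 1)
          + (HahnSeries.ofPowerSeries ℤ k b) * (HahnSeries.ofPowerSeries ℤ k d)
            * laurentT k ^ (-1 : ℤ)
        = algebraMap k (LaurentSeries k) (μ₀ * s ^ (m + 2)) * laurentT k ^ (-1 : ℤ) ∧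
      (HahnSeries.ofPowerSeries ℤ k c) ^ 2 * laurentT k ^ ((m : ℤ) + 1)
          + (HahnSeries.ofPowerSeries ℤ k d) ^ 2 * laurentT k ^ (-1 : ℤ)
        = algebraMap k (LaurentSeries k) (s ^ 2) * laurentT k ^ (-1 : ℤ) + 1 := by
  have h2 : (2 : k) ≠ 0 := Ring.two_ne_zero hchar
  have hq : (μ₀ * s ^ (m + 2)) ^ 2 = -(-s ^ 2) ^ (m + 2) := by
    rw [mul_pow, hμ, neg_pow (s ^ 2)]
    ring
  obtain ⟨a, b, d, had, h₁, h₂, h₃⟩ :=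
    PowerSeries.exists_upper_triangular_congruence h2 (m + 2) hs hq
  have hT : laurentT k ≠ 0 := HahnSeries.single_ne_zero one_ne_zero
  have hX : HahnSeries.ofPowerSeries ℤ k PowerSeries.X = laurentT k :=
    HahnSeries.ofPowerSeries_X
  have hC (x : k) : HahnSeries.ofPowerSeries ℤ k (PowerSeries.C x) =
      algebraMap k (LaurentSeries k) x := by
    rw [HahnSeries.ofPowerSeries_C, LaurentSeries.algebraMap_apply]
  have hpow : laurentT k ^ ((m : ℤ) + 1) = laurentT k ^ (m + 2) * laurentT k ^ (-1 : ℤ) := by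
    rw [← zpow_natCast, ← zpow_add₀ hT]
    congr 1
    push_cast
    ring
  have hinv : laurentT k * laurentT k ^ (-1 : ℤ) = 1 := by
    rw [zpow_neg_one, mul_inv_cancel₀ hT]
  replace h₁ := congrArg (HahnSeries.ofPowerSeries ℤ k) h₁
  replace h₂ := congrArg (HahnSeries.ofPowerSeries ℤ k) h₂
  replace h₃ := congrArg (HahnSeries.ofPowerSeries ℤ k) h₃
  simp only [map_add, map_mul, map_sum, map_pow (HahnSeries.ofPowerSeries ℤ k), hX, hC] at h₁ h₂ h₃
  refine ⟨a, b, 0, d, by rw [had, mul_zero, sub_zero], ?_, ?_, ?_⟩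
  · have hsum : ∑ i ∈ Finset.range (m + 2),
        algebraMap k (LaurentSeries k) ((-s ^ 2) ^ (m + 1 - i)) * laurentT k ^ ((i : ℤ) - 1) =
        (∑ i ∈ Finset.range (m + 2), laurentT k ^ i *
          algebraMap k (LaurentSeries k) (-s ^ 2) ^ (m + 2 - 1 - i)) * laurentT k ^ (-1 : ℤ) := by
      rw [Finset.sum_mul]
      refine Finset.sum_congr rfl fun i _ => ?_
      rw [sub_eq_add_neg, zpow_add₀ hT, zpow_natCast, map_pow, show m + 2 - 1 - i = m + 1 - i from rfl]
      ring
    rw [hsum, ← h₁, hpow]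
    ring
  · rw [map_zero, mul_zero, zero_mul, zero_add, h₂, map_mul]
  · rw [map_zero, h₃]
    linear_combination hinv
end

section
/- Let k be an algebraically closed field of characteristic different from 2, let m ≥ 0 be an integer, and let μ₀ ∈ k satisfy μ₀² = (−1)^{m+1}. Then for every nonzero s ∈ k there exist polynomials b = Σ_{i=0}^{m+1} bᵢ tⁱ and d = Σ_{i=0}^{m+1} dᵢ tⁱ of degree at most m+1 with coefficients in k such that in k[[t]]: b² ≡ Σ_{i=0}^{m+1} (−s²)^{m+1−i} tⁱ (mod t^{m+2}), d² ≡ s² + t (mod t^{m+2}), and b·d ≡ μ₀·s^{m+2} (mod t^{m+2}). -/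
open Polynomial

namespace Polynomial

lemma exists_natDegree_le_X_pow_dvd_sub {R : Type*} [CommRing R] [Nontrivial R]
    (p : R[X]) (n : ℕ) : ∃ r : R[X], r.natDegree ≤ n ∧ X ^ (n + 1) ∣ r - p := by
  refine ⟨p %ₘ X ^ (n + 1), ?_, -(p /ₘ X ^ (n + 1)), ?_⟩
  · have h := natDegree_modByMonic_lt p (monic_X_pow (R := R) (n + 1))
      (fun h => by simpa using congrArg natDegree h)
    rw [natDegree_X_pow] at h
    omega
  · linear_combination modByMonic_add_div p (X ^ (n + 1))

/-- A polynomial whose constant term is a nonzero square has square roots modulo all powers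
of `X`, away from characteristic two. -/
lemma exists_X_pow_dvd_sq_sub {K : Type*} [Field K] (h2 : (2 : K) ≠ 0) {s : K} (hs : s ≠ 0)
    {f : K[X]} (hf : f.coeff 0 = s ^ 2) (n : ℕ) :
    ∃ d : K[X], d.coeff 0 = s ∧ X ^ (n + 1) ∣ d ^ 2 - f := by
  induction n with
  | zero =>
    refine ⟨C s, by simp, ?_⟩
    rw [zero_add, pow_one, X_dvd_iff]
    simp [hf, pow_two]
  | succ n ih =>
    obtain ⟨d, hd, q, hq⟩ := ih
    have hX : X ∣ q + 2 * C (-q.coeff 0 / (2 * s)) * d := by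
      rw [X_dvd_iff]
      simp only [coeff_add, mul_coeff_zero, coeff_C_zero, coeff_ofNat_zero, hd]
      field_simp
      ring
    obtain ⟨r, hr⟩ := hX
    refine ⟨d + C (-q.coeff 0 / (2 * s)) * X ^ (n + 1), by simp [hd],
      r + C (-q.coeff 0 / (2 * s)) ^ 2 * X ^ n, ?_⟩
    linear_combination hq + X ^ (n + 1) * hr

end Polynomial

/-- Step one of the GL₂/O₂ closure-curve proposition: for an algebraically closed field `k`
of characteristic `≠ 2`, `m ≥ 0`, `μ₀² = (−1)^{m+1}`, and `s ≠ 0`, there exist polynomials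
`b, d` of degree at most `m+1` over `k` with
`b² ≡ Σ_{i=0}^{m+1} (−s²)^{m+1−i} tⁱ`, `d² ≡ s² + t`, and `b·d ≡ μ₀·s^{m+2}` mod `t^{m+2}`
(coefficients of index `< m+2` agree). -/
theorem gl2_o2_closure_curve_mod (k : Type*) [Field k] [IsAlgClosed k]
    (hchar : ringChar k ≠ 2) (m : ℕ) (μ₀ : k) (hμ : μ₀ ^ 2 = (-1 : k) ^ (m + 1))
    (s : k) (hs : s ≠ 0) :
    ∃ b d : Polynomial k,
      b.natDegree ≤ m + 1 ∧ d.natDegree ≤ m + 1 ∧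
      (∀ i < m + 2, (b ^ 2).coeff i =
        (∑ j ∈ Finset.range (m + 2), C ((-s ^ 2) ^ (m + 1 - j)) * X ^ j : Polynomial k).coeff i) ∧
      (∀ i < m + 2, (d ^ 2).coeff i = (C (s ^ 2) + X : Polynomial k).coeff i) ∧
      (∀ i < m + 2, (b * d).coeff i = (C (μ₀ * s ^ (m + 2)) : Polynomial k).coeff i) := by
  have hμ₀ : μ₀ ≠ 0 := by
    rintro rfl
    exact pow_ne_zero (m + 1) (neg_ne_zero.mpr (one_ne_zero (α := k))) (by simpa using hμ.symm)
  have hc : μ₀ * s ^ (m + 2) ≠ 0 := mul_ne_zero hμ₀ (pow_ne_zero _ hs)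
  have hc2 : (μ₀ * s ^ (m + 2)) ^ 2 = -(-s ^ 2) ^ (m + 2) := by
    rw [mul_pow, hμ, neg_pow (s ^ 2)]
    ring
  set c := μ₀ * s ^ (m + 2)
  set G : k[X] := ∑ j ∈ Finset.range (m + 2), C ((-s ^ 2) ^ (m + 1 - j)) * X ^ j with hG
  have hGe : G * (C (s ^ 2) + X) = C c ^ 2 + X ^ (m + 2) := by
    have h := (Commute.all (X : k[X]) (C (-s ^ 2))).geom_sum₂_mul (m + 2)
    have hsum : ∑ i ∈ Finset.range (m + 2), (X : k[X]) ^ i * C (-s ^ 2) ^ (m + 2 - 1 - i) = G := by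
      rw [hG]
      refine Finset.sum_congr rfl fun j _ => ?_
      rw [C_pow, mul_comm]
      rfl
    rw [hsum] at h
    rw [← C_pow, hc2]
    simp only [C_neg, C_pow] at h ⊢
    linear_combination h
  have hu : C c⁻¹ * C c = 1 := by rw [← C_mul, inv_mul_cancel₀ hc, C_1]
  obtain ⟨d₀, -, q, hq⟩ := exists_X_pow_dvd_sq_sub (Ring.two_ne_zero hchar) hs
    (f := C (s ^ 2) + X) (by simp [pow_two]) (m + 1)
  obtain ⟨d, hd, v, hv⟩ := exists_natDegree_le_X_pow_dvd_sub d₀ (m + 1)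
  obtain ⟨b, hb, w, hw⟩ := exists_natDegree_le_X_pow_dvd_sub (C c⁻¹ * G * d) (m + 1)
  have hd2 : d ^ 2 - (C (s ^ 2) + X) = X ^ (m + 2) * (q + v * (d + d₀)) := by
    linear_combination hq + (d + d₀) * hv
  have hbd : b * d - C c = X ^ (m + 2) * (w * d + C c⁻¹ * G * (q + v * (d + d₀)) + C c⁻¹) := by
    linear_combination d * hw + C c⁻¹ * G * hd2 + C c⁻¹ * hGe + C c * hu
  have hb2 : X ^ (m + 2) ∣ b ^ 2 - G := by
    refine ⟨w * b + C c⁻¹ * G * (w * d + C c⁻¹ * G * (q + v * (d + d₀)) + C c⁻¹), ?_⟩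
    linear_combination b * hw + C c⁻¹ * G * hbd + G * hu
  have coeff_eq {p r : k[X]} (h : X ^ (m + 2) ∣ p - r) (i : ℕ) (hi : i < m + 2) :
      p.coeff i = r.coeff i := by
    rw [← sub_eq_zero, ← coeff_sub]
    exact X_pow_dvd_iff.mp h i hi
  exact ⟨b, d, hb, hd, coeff_eq hb2, coeff_eq ⟨_, hd2⟩, coeff_eq ⟨_, hbd⟩⟩
end

section
/- Let k be a field, m ≥ 0 an integer, and μ₀ ∈ k with μ₀² = (−1)^{m+1}. Let λ₀, λ₁, …, λ_{m+1} ∈ k satisfy λ₀ = 1, Σ_{k=0}^{1} λ_k λ_{1−k} = 1 (i.e. 2λ₁ = 1), and Σ_{k=0}^{i} λ_k λ_{i−k} = 0 for all 2 ≤ i ≤ m+1 (equivalently, (Σ_{i=0}^{m+1} λᵢ tⁱ)² ≡ 1 + t modulo t^{m+2}). Define μᵢ = μ₀ · Σ_{k=0}^{i} (−1)^k λ_{i−k} for 0 ≤ i ≤ m+1. Then Σ_{k=0}^{i} μ_k μ_{i−k} = (−1)^{m+1−i} for every 0 ≤ i ≤ m+1. -/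
/-- Coefficients of a product of power series as a sum over a range. -/
theorem PowerSeries.coeff_mk_mul_mk {R : Type*} [Semiring R] (f g : ℕ → R) (n : ℕ) :
    PowerSeries.coeff n (PowerSeries.mk f * PowerSeries.mk g) =
      ∑ j ∈ Finset.range (n + 1), f j * g (n - j) := by
  simp only [PowerSeries.coeff_mul, PowerSeries.coeff_mk]
  exact Finset.Nat.sum_antidiagonal_eq_sum_range_succ (fun a b => f a * g b) n

/-- The alternating geometric series is the inverse of `1 + X`. -/
theorem PowerSeries.mk_neg_one_pow_mul_one_add_X {R : Type*} [CommRing R] :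
    PowerSeries.mk (fun j => (-1 : R) ^ j) * (1 + PowerSeries.X) = 1 := by
  ext n
  cases n with
  | zero => simp [mul_add]
  | succ n =>
    simp [mul_add, PowerSeries.coeff_succ_mul_X, PowerSeries.coeff_one, pow_succ]

/-- Coefficient identity in the proof of the GL₂/O₂ closure-curve proposition:
if `λ₀ = 1`, `Σ_{k=0}^{1} λ_k λ_{1−k} = 1`, `Σ_{k=0}^{i} λ_k λ_{i−k} = 0` for `2 ≤ i ≤ m+1`
(so `(Σ λᵢ tⁱ)² ≡ 1 + t mod t^{m+2}`), and `μᵢ = μ₀ · Σ_{k=0}^{i} (−1)^k λ_{i−k}` with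
`μ₀² = (−1)^{m+1}`, then `Σ_{k=0}^{i} μ_k μ_{i−k} = (−1)^{m+1−i}` for all `0 ≤ i ≤ m+1`. -/
theorem gl2_o2_coefficient_identity (k : Type*) [Field k] (m : ℕ) (μ₀ : k)
    (hμ₀ : μ₀ ^ 2 = (-1 : k) ^ (m + 1))
    (lam : ℕ → k) (hlam0 : lam 0 = 1)
    (hlam1 : ∑ j ∈ Finset.range 2, lam j * lam (1 - j) = 1)
    (hlam : ∀ i, 2 ≤ i → i ≤ m + 1 → ∑ j ∈ Finset.range (i + 1), lam j * lam (i - j) = 0)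
    (mu : ℕ → k)
    (hmu : ∀ i ≤ m + 1, mu i = μ₀ * ∑ j ∈ Finset.range (i + 1), (-1 : k) ^ j * lam (i - j)) :
    ∀ i ≤ m + 1, ∑ j ∈ Finset.range (i + 1), mu j * mu (i - j) = (-1 : k) ^ (m + 1 - i) := by
  intro i hi
  set L := PowerSeries.mk lam with hL
  set G := PowerSeries.mk (fun j => (-1 : k) ^ j) with hG
  have hG1 : G * (1 + PowerSeries.X) = 1 := PowerSeries.mk_neg_one_pow_mul_one_add_X
  have hdvd : (PowerSeries.X : PowerSeries k) ^ (m + 2) ∣ L * L - (1 + PowerSeries.X) := by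
    rw [PowerSeries.X_pow_dvd_iff]
    intro n hn
    rw [map_sub, hL, PowerSeries.coeff_mk_mul_mk, sub_eq_zero]
    match n with
    | 0 => simp [hlam0]
    | 1 => simpa [PowerSeries.coeff_one] using hlam1
    | n + 2 =>
      rw [hlam (n + 2) (by omega) (by omega)]
      simp [PowerSeries.coeff_one, PowerSeries.coeff_X]
  have hGL : PowerSeries.coeff i ((G * L) * (G * L)) = (-1 : k) ^ i := by
    have h : (G * L) * (G * L) - G = G * G * (L * L - (1 + PowerSeries.X)) := by
      linear_combination G * hG1
    have h0 := PowerSeries.X_pow_dvd_iff.1 (h ▸ hdvd.mul_left (G * G)) i (by omega)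
    rw [map_sub, sub_eq_zero] at h0
    simpa [hG] using h0
  have hmu' : ∀ j ≤ m + 1, mu j = μ₀ * PowerSeries.coeff j (G * L) := fun j hj => by
    rw [hmu j hj, hG, hL, PowerSeries.coeff_mk_mul_mk]
  calc ∑ j ∈ Finset.range (i + 1), mu j * mu (i - j)
      = μ₀ ^ 2 * ∑ j ∈ Finset.range (i + 1),
          PowerSeries.coeff j (G * L) * PowerSeries.coeff (i - j) (G * L) := by
        rw [Finset.mul_sum]
        refine Finset.sum_congr rfl fun j hj => ?_
        have := Finset.mem_range.1 hj
        rw [hmu' j (by omega), hmu' (i - j) (by omega)]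
        ring
    _ = (-1 : k) ^ (m + 1) * (-1 : k) ^ i := by
        rw [hμ₀, ← hGL, PowerSeries.coeff_mul, Finset.Nat.sum_antidiagonal_eq_sum_range_succ
          (fun a b => PowerSeries.coeff a (G * L) * PowerSeries.coeff b (G * L))]
    _ = (-1 : k) ^ (m + 1 - i) := by
        obtain ⟨d, hd⟩ := Nat.exists_eq_add_of_le hi
        rw [hd, Nat.add_sub_cancel_left, pow_add, mul_right_comm, ← mul_pow]
        simp
end

section
/- Let R be a commutative ring in which 2 is invertible, let A be a commutative R-algebra that is formally smooth over R, and let σ be an R-algebra automorphism of A with σ ∘ σ = id. Let I ⊆ A be the ideal generated by the set {a − σ(a) : a ∈ A}. Then the quotient R-algebra A ⧸ I is formally smooth over R. -/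
universe u

/-- If the difference of two algebra homomorphisms takes values in a square-zero ideal and `2` is
invertible, then their average is again an algebra homomorphism. -/
theorem exists_algHom_two_mul_eq_add_of_sub_mem {R A B : Type*} [CommRing R] [CommRing A]
    [CommRing B] [Algebra R A] [Algebra R B] (h2 : IsUnit (2 : B)) {J : Ideal B} (hJ : J ^ 2 = ⊥)
    (f g : A →ₐ[R] B) (hfg : ∀ a, f a - g a ∈ J) :
    ∃ h : A →ₐ[R] B, ∀ a, 2 * h a = f a + g a := by
  obtain ⟨c, hc⟩ := h2.exists_right_inv
  have hmul (a b : A) : (f a - g a) * (f b - g b) = 0 := by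
    rw [← Ideal.mem_bot, ← hJ, sq]
    exact Ideal.mul_mem_mul (hfg a) (hfg b)
  refine ⟨AlgHom.ofLinearMap (LinearMap.mulLeft R c ∘ₗ (f.toLinearMap + g.toLinearMap)) ?_ ?_, ?_⟩
  · simp only [LinearMap.comp_apply, LinearMap.add_apply, AlgHom.toLinearMap_apply, map_one,
      LinearMap.mulLeft_apply]
    linear_combination hc
  · intro a b
    simp only [LinearMap.comp_apply, LinearMap.add_apply, AlgHom.toLinearMap_apply, map_mul,
      LinearMap.mulLeft_apply]
    linear_combination c ^ 2 * hmul a b - c * (f a * f b + g a * g b) * hc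
  · intro a
    simp only [AlgHom.ofLinearMap_apply, LinearMap.comp_apply, LinearMap.add_apply,
      AlgHom.toLinearMap_apply, LinearMap.mulLeft_apply]
    linear_combination (f a + g a) * hc

/-- Affine form of the fixed-points lemma: if `2` is invertible in `R`, `A` is a formally
smooth commutative `R`-algebra, and `σ` is an `R`-algebra involution of `A`, then the
quotient of `A` by the ideal generated by `{a − σ(a) : a ∈ A}` (the coordinate ring of the
fixed-point subscheme of `σ`) is again formally smooth over `R`. -/
theorem formallySmooth_fixedPoints_of_involution (R : Type u) [CommRing R]
    (h2 : IsUnit (2 : R)) (A : Type u) [CommRing A] [Algebra R A]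
    [Algebra.FormallySmooth R A] (σ : A →ₐ[R] A) (hσ : σ.comp σ = AlgHom.id R A) :
    Algebra.FormallySmooth R (A ⧸ Ideal.span (Set.range fun a : A => a - σ a)) := by
  set I := Ideal.span (Set.range fun a : A => a - σ a)
  rw [Algebra.FormallySmooth.iff_comp_surjective]
  intro B _ _ J hJ f
  have hσσ (a : A) : σ (σ a) = a := DFunLike.congr_fun hσ a
  have h2B : IsUnit (2 : B) := by
    simpa only [map_ofNat] using h2.map (algebraMap R B)
  obtain ⟨g, hg⟩ :=
    Algebra.FormallySmooth.comp_surjective R A J hJ (f.comp (Ideal.Quotient.mkₐ R I))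
  have hg (a : A) : Ideal.Quotient.mk J (g a) = f (Ideal.Quotient.mk I a) :=
    DFunLike.congr_fun hg a
  have hmk (a : A) : Ideal.Quotient.mk I a = Ideal.Quotient.mk I (σ a) :=
    Ideal.Quotient.eq.mpr (Ideal.subset_span ⟨a, rfl⟩)
  obtain ⟨h, hh⟩ := exists_algHom_two_mul_eq_add_of_sub_mem h2B hJ g (g.comp σ) fun a => by
    rw [← Ideal.Quotient.eq, AlgHom.comp_apply, hg, hg, ← hmk]
  have hI : I ≤ RingHom.ker h := by
    refine Ideal.span_le.mpr ?_
    rintro _ ⟨a, rfl⟩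
    rw [SetLike.mem_coe, RingHom.mem_ker, map_sub, sub_eq_zero]
    apply h2B.mul_left_cancel
    rw [hh, hh, AlgHom.comp_apply, AlgHom.comp_apply, hσσ, add_comm]
  refine ⟨Ideal.Quotient.liftₐ I h hI, Ideal.Quotient.algHom_ext _ (AlgHom.ext fun a => ?_)⟩
  change Ideal.Quotient.mk J (h a) = f (Ideal.Quotient.mk I a)
  apply (h2B.map (Ideal.Quotient.mk J)).mul_left_cancel
  rw [← map_mul, hh, map_add, AlgHom.comp_apply, hg, hg, ← hmk, map_ofNat, two_mul]
end
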